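/- There exists a constant C* > 0, depending only on K₀, μ, α, and κ, such that 𝒢(ξ,η) : η ≤ C*|η|² for all ξ, η ∈ 𝕄²ˣ²_sym. -/

import Mathlib

open Matrix Set
open scoped Classical

attribute [local instance] Matrix.frobeniusNormedAddCommGroup Matrix.frobeniusNormedSpace

noncomputable section

/-- The space of real 2×2 matrices (symmetric ones are singled out by `Matrix.IsSymm`). -/
abbrev M2 : Type := Matrix (Fin 2) (Fin 2) ℝ

/-- Frobenius inner product `A : B = tr (Aᵀ B)`. -/
def inn (A B : M2) : ℝ := (Aᵀ * B).trace

/-- Frobenius norm `|A| = √(A : A)`. -/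
def fnorm (A : M2) : ℝ := Real.sqrt (inn A A)

/-- Deviatoric part `A_D = A − (tr A / 2) Id`. -/
def dev (A : M2) : M2 := A - (A.trace / 2) • (1 : M2)

/-- The set of symmetric matrices `𝕄²ˣ²_sym`. -/
def Msym : Set M2 := {A | A.IsSymm}

/-- The Drucker–Prager elasticity set `K = {σ ∈ 𝕄²ˣ²_sym : |σ_D| + α tr σ ≤ κ}`. -/
def Kset (α κ : ℝ) : Set M2 :=
  {σ | σ.IsSymm ∧ fnorm (dev σ) + α * σ.trace ≤ κ}

/-- The isotropic elasticity tensor `ℂ e = λ (tr e) Id + 2 μ e`. -/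
def Cc (lam mu : ℝ) (e : M2) : M2 := (lam * e.trace) • (1 : M2) + (2 * mu) • e

/-- The inverse elasticity tensor `ℂ⁻¹ σ = (tr σ / (4 K₀)) Id + (1/(2μ)) σ_D`, `K₀ = λ + μ`. -/
def Cinv (lam mu : ℝ) (σ : M2) : M2 :=
  (σ.trace / (4 * (lam + mu))) • (1 : M2) + (1 / (2 * mu)) • dev σ

/-- The constant `β = (1/μ + 1/(2 α² K₀))⁻¹`. -/
def betaC (α lam mu : ℝ) : ℝ := (1 / mu + 1 / (2 * α ^ 2 * (lam + mu)))⁻¹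

/-- The function `g`. -/
def gfun (α κ lam mu : ℝ) (ξ : M2) : ℝ :=
  if 2 * mu * fnorm (dev ξ) + 2 * α * (lam + mu) * ξ.trace ≤ κ then
    ((lam + mu) / 2) * ξ.trace ^ 2 + mu * fnorm (dev ξ) ^ 2
  else
    κ * ξ.trace / (2 * α) - κ ^ 2 / (8 * α ^ 2 * (lam + mu)) +
      betaC α lam mu *
        max (fnorm (dev ξ) - ξ.trace / (2 * α) + κ / (4 * α ^ 2 * (lam + mu))) 0 ^ 2

/-- The (matrix representing the) differential of `g`. -/
def Dg (α κ lam mu : ℝ) (ξ : M2) : M2 :=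
  if 2 * mu * fnorm (dev ξ) + 2 * α * (lam + mu) * ξ.trace ≤ κ then
    ((lam + mu) * ξ.trace) • (1 : M2) + (2 * mu) • dev ξ
  else
    (κ / (2 * α)) • (1 : M2) +
      (2 * betaC α lam mu *
          max (fnorm (dev ξ) - ξ.trace / (2 * α) + κ / (4 * α ^ 2 * (lam + mu))) 0) •
        ((fnorm (dev ξ))⁻¹ • dev ξ - (1 / (2 * α)) • (1 : M2))

/-- The open cone `𝒜₁ = {ξ ∈ 𝕄²ˣ²_sym : μ |ξ_D| + α K₀ tr ξ < 0}`. -/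
def A1 (α lam mu : ℝ) : Set M2 :=
  {ξ | ξ.IsSymm ∧ mu * fnorm (dev ξ) + α * (lam + mu) * ξ.trace < 0}

/-- The open cone `𝒜₂ = {ξ ∈ 𝕄²ˣ²_sym : |ξ_D| < tr ξ / (2α)}`. -/
def A2 (α : ℝ) : Set M2 :=
  {ξ | ξ.IsSymm ∧ fnorm (dev ξ) < ξ.trace / (2 * α)}

/-- The cone `𝒜₃ = 𝕄²ˣ²_sym ∖ (cl 𝒜₁ ∪ cl 𝒜₂)`. -/
def A3 (α lam mu : ℝ) : Set M2 :=
  Msym \ (closure (A1 α lam mu) ∪ closure (A2 α))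

/-- The function `G(ξ) = Dg(ξ + (κ/(4αK₀)) Id)`, given by its explicit piecewise expression. -/
def Gfun (α κ lam mu : ℝ) (ξ : M2) : M2 :=
  if ξ ∈ A1 α lam mu then
    (κ / (2 * α)) • (1 : M2) + ((lam + mu) * ξ.trace) • (1 : M2) + (2 * mu) • dev ξ
  else if ξ ∈ A2 α ∨ ξ = 0 then
    (κ / (2 * α)) • (1 : M2)
  else
    (κ / (2 * α)) • (1 : M2) +
      (2 * betaC α lam mu * (fnorm (dev ξ) - ξ.trace / (2 * α))) •
        ((fnorm (dev ξ))⁻¹ • dev ξ - (1 / (2 * α)) • (1 : M2))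

/-- The map `𝒢(ξ, η)`. -/
def calG (α lam mu : ℝ) (ξ η : M2) : M2 :=
  if ξ ∈ A1 α lam mu then
    ((lam + mu) * η.trace) • (1 : M2) + (2 * mu) • dev η
  else if ξ ∈ A2 α ∨ ξ = 0 then
    0
  else
    (2 * betaC α lam mu * (inn (dev ξ) (dev η) / fnorm (dev ξ) - η.trace / (2 * α))) •
      ((fnorm (dev ξ))⁻¹ • dev ξ - (1 / (2 * α)) • (1 : M2)) +
    (2 * betaC α lam mu * (fnorm (dev ξ) - ξ.trace / (2 * α)) * (fnorm (dev ξ))⁻¹) •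
      (dev η - (inn (dev ξ) (dev η) / fnorm (dev ξ) ^ 2) • dev ξ)

/-- The relative boundary `∂𝒜₁` of `𝒜₁` inside `𝕄²ˣ²_sym`. -/
def bdryA1 (α lam mu : ℝ) : Set M2 := closure (A1 α lam mu) \ A1 α lam mu

/-- The relative boundary `∂𝒜₂` of `𝒜₂` inside `𝕄²ˣ²_sym`. -/
def bdryA2 (α : ℝ) : Set M2 := closure (A2 α) \ A2 α

/-- The outward normal `ν(σ) = μ σ_D/|σ_D| + α K₀ Id` for `σ ∈ ∂𝒜₁ ∖ {0}`. -/
def nu1 (α lam mu : ℝ) (σ : M2) : M2 :=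
  (mu * (fnorm (dev σ))⁻¹) • dev σ + (α * (lam + mu)) • (1 : M2)

/-- The outward normal `ν(σ) = σ_D/|σ_D| − (1/(2α)) Id` for `σ ∈ ∂𝒜₂ ∖ {0}`. -/
def nu2 (α : ℝ) (σ : M2) : M2 :=
  (fnorm (dev σ))⁻¹ • dev σ - (1 / (2 * α)) • (1 : M2)

lemma inn_add_left (A B C : M2) : inn (A + B) C = inn A C + inn B C := by
  simp [inn, Matrix.add_mul]

lemma inn_sub_left (A B C : M2) : inn (A - B) C = inn A C - inn B C := by
  simp [inn, Matrix.sub_mul]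

lemma inn_smul_left (c : ℝ) (A B : M2) : inn (c • A) B = c * inn A B := by
  simp [inn]

lemma inn_one_left (A : M2) : inn 1 A = A.trace := by
  simp [inn]

lemma inn_eq_sum (A B : M2) :
    inn A B = A 0 0 * B 0 0 + A 1 0 * B 1 0 + (A 0 1 * B 0 1 + A 1 1 * B 1 1) := by
  simp [inn, Matrix.trace_fin_two, Matrix.mul_apply, Fin.sum_univ_two]

lemma inn_self_nonneg (A : M2) : 0 ≤ inn A A := by
  rw [inn_eq_sum]
  nlinarith [mul_self_nonneg (A 0 0), mul_self_nonneg (A 1 0), mul_self_nonneg (A 0 1),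
    mul_self_nonneg (A 1 1)]

lemma fnorm_sq (A : M2) : fnorm A ^ 2 = inn A A :=
  Real.sq_sqrt (inn_self_nonneg A)

lemma inn_dev_left (A B : M2) : inn (dev A) B = inn (dev A) (dev B) := by
  simp [inn_eq_sum, dev, Matrix.trace_fin_two]
  ring

/-- Orthogonality of the spherical and deviatoric parts. -/
lemma inn_self_eq (A : M2) : inn A A = A.trace ^ 2 / 2 + inn (dev A) (dev A) := by
  simp [inn_eq_sum, dev, Matrix.trace_fin_two]
  ring

lemma eq_zero_of_inn_dev_self {A : M2} (ht : A.trace = 0) (hd : inn (dev A) (dev A) = 0) :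
    A = 0 := by
  have h : inn A A = 0 := by rw [inn_self_eq, ht, hd]; norm_num
  rw [inn_eq_sum] at h
  ext i j
  fin_cases i <;> fin_cases j <;> simp <;>
    nlinarith [mul_self_nonneg (A 0 0), mul_self_nonneg (A 1 0), mul_self_nonneg (A 0 1),
      mul_self_nonneg (A 1 1)]

/-- Cauchy-Schwarz inequality for the Frobenius inner product. -/
lemma inn_sq_le (A B : M2) : inn A B ^ 2 ≤ inn A A * inn B B := by
  have h := Finset.sum_mul_sq_le_sq_mul_sq Finset.univ
    (fun k : Fin 2 × Fin 2 => A k.1 k.2) (fun k => B k.1 k.2)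
  simp only [Fintype.sum_prod_type, Fin.sum_univ_two] at h
  simp only [inn_eq_sum]
  linarith

lemma betaC_pos {α lam mu : ℝ} (hα : 0 < α) (hmu : 0 < mu) (hlm : 0 < lam + mu) :
    0 < betaC α lam mu := by
  unfold betaC
  positivity

lemma fnorm_dev_pos {α lam mu : ℝ} (hα : 0 < α) (hlm : 0 < lam + mu) {ξ : M2}
    (h1 : 0 ≤ mu * fnorm (dev ξ) + α * (lam + mu) * ξ.trace)
    (h2 : ξ.trace / (2 * α) ≤ fnorm (dev ξ)) (h0 : ξ ≠ 0) : 0 < fnorm (dev ξ) := by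
  refine lt_of_le_of_ne (Real.sqrt_nonneg _) fun hr => h0 ?_
  rw [← hr] at h1 h2
  have ht : ξ.trace ≤ 0 := by
    rw [div_le_iff₀ (by positivity)] at h2
    simpa using h2
  have ht' : 0 ≤ ξ.trace := by
    have : 0 ≤ α * (lam + mu) * ξ.trace := by simpa using h1
    exact nonneg_of_mul_nonneg_right this (by positivity)
  refine eq_zero_of_inn_dev_self (le_antisymm ht ht') ?_
  rw [← fnorm_sq, ← hr]
  norm_num

/-- The tangential factor in the third cone is bounded. -/
lemma tangential_factor_le {α K mu r T : ℝ} (hα : 0 < α) (hK : 0 < K) (hr : 0 < r)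
    (h : 0 ≤ mu * r + α * K * T) :
    (r - T / (2 * α)) * r⁻¹ ≤ 1 + mu / (2 * α ^ 2 * K) := by
  have key : 1 + mu / (2 * α ^ 2 * K) - (r - T / (2 * α)) * r⁻¹
      = (mu * r + α * K * T) / (2 * α ^ 2 * K * r) := by
    field_simp
    ring
  have : 0 ≤ (mu * r + α * K * T) / (2 * α ^ 2 * K * r) := by positivity
  linarith

/-- There is `C* > 0` (depending only on `K₀`, `μ`, `α`, `κ`) with
`𝒢(ξ,η) : η ≤ C* |η|²` for all symmetric `ξ, η`. -/
theorem stmt_15 (α κ lam mu : ℝ) (hα : 0 < α) (hκ : 0 < κ) (hmu : 0 < mu)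
    (hlm : 0 < lam + mu) :
    ∃ Cstar : ℝ, 0 < Cstar ∧ ∀ ξ η : M2, ξ.IsSymm → η.IsSymm →
      inn (calG α lam mu ξ η) η ≤ Cstar * fnorm η ^ 2 := by
  have hβ := betaC_pos hα hmu hlm
  set β := betaC α lam mu
  set k := 1 + mu / (2 * α ^ 2 * (lam + mu)) with hk
  have hkpos : 0 < k := by positivity
  have hC : 0 < 2 * (lam + mu) + 2 * mu + 4 * β + 2 * β / α ^ 2 + 2 * β * k := by positivity
  refine ⟨_, hC, fun ξ η hξ _ => ?_⟩
  have hn := inn_self_nonneg (dev η)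
  set n := inn (dev η) (dev η) with hndef
  set t := η.trace with htdef
  have ht := sq_nonneg t
  rw [fnorm_sq, inn_self_eq, ← hndef, ← htdef]
  have hβα : 0 < β / α ^ 2 := by positivity
  have hβk : 0 < β * k := by positivity
  have hexp : (2 * (lam + mu) + 2 * mu + 4 * β + 2 * β / α ^ 2 + 2 * β * k) * (t ^ 2 / 2 + n)
      = (lam + mu) * t ^ 2 + mu * t ^ 2 + 2 * (β * t ^ 2) + β / α ^ 2 * t ^ 2 + β * k * t ^ 2
        + 2 * ((lam + mu) * n) + 2 * (mu * n) + 4 * (β * n) + 2 * (β / α ^ 2 * n)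
        + 2 * (β * k * n) := by ring
  rw [hexp]
  have e1 := mul_nonneg hlm.le ht
  have e2 := mul_nonneg hmu.le ht
  have e3 := mul_nonneg hβ.le ht
  have e4 := mul_nonneg hβα.le ht
  have e5 := mul_nonneg hβk.le ht
  have f1 := mul_nonneg hlm.le hn
  have f2 := mul_nonneg hmu.le hn
  have f3 := mul_nonneg hβ.le hn
  have f4 := mul_nonneg hβα.le hn
  have f5 := mul_nonneg hβk.le hn
  unfold calG
  split_ifs with h1 h2
  · rw [inn_add_left, inn_smul_left, inn_smul_left, inn_one_left, inn_dev_left, ← hndef, ← htdef]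
    nlinarith
  · have : inn 0 η = 0 := by simp [inn]
    rw [this]
    positivity
  · push Not at h2
    have h1' : 0 ≤ mu * fnorm (dev ξ) + α * (lam + mu) * ξ.trace :=
      not_lt.mp fun h => h1 ⟨hξ, h⟩
    have h2' : ξ.trace / (2 * α) ≤ fnorm (dev ξ) := not_lt.mp fun h => h2.1 ⟨hξ, h⟩
    have hr := fnorm_dev_pos hα hlm h1' h2' h2.2
    have hfac := tangential_factor_le hα hlm hr h1'
    rw [← hk] at hfac
    have hcs := inn_sq_le (dev ξ) (dev η)
    rw [← fnorm_sq (dev ξ), ← hndef] at hcs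
    simp only [inn_add_left, inn_sub_left, inn_smul_left, inn_one_left]
    rw [inn_dev_left η η, inn_dev_left ξ η, ← hndef, ← htdef]
    set r := fnorm (dev ξ)
    set s := inn (dev ξ) (dev η)
    have hsr : (s / r) ^ 2 ≤ n := by
      rw [div_pow, div_le_iff₀ (by positivity)]
      linarith
    have hlhs : 2 * β * (s / r - t / (2 * α)) * (r⁻¹ * s - 1 / (2 * α) * t)
          + 2 * β * (r - ξ.trace / (2 * α)) * r⁻¹ * (n - s / r ^ 2 * s)
        = 2 * β * (s / r - t / (2 * α)) ^ 2
          + 2 * β * ((r - ξ.trace / (2 * α)) * r⁻¹ * (n - (s / r) ^ 2)) := by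
      ring
    rw [hlhs]
    have hradial : (s / r - t / (2 * α)) ^ 2 ≤ 2 * n + t ^ 2 / α ^ 2 / 2 := by
      have h := sq_nonneg (s / r + t / (2 * α))
      have e : (t / (2 * α)) ^ 2 = t ^ 2 / α ^ 2 / 4 := by ring
      nlinarith
    have htang : (r - ξ.trace / (2 * α)) * r⁻¹ * (n - (s / r) ^ 2) ≤ k * n :=
      mul_le_mul hfac (by linarith [sq_nonneg (s / r)]) (by linarith) hkpos.le
    have g1 := mul_le_mul_of_nonneg_left hradial hβ.le
    have g2 := mul_le_mul_of_nonneg_left htang hβ.le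
    have e6 : β * (2 * n + t ^ 2 / α ^ 2 / 2) = 2 * (β * n) + β / α ^ 2 * t ^ 2 / 2 := by ring
    have e7 : β * (k * n) = β * k * n := by ring
    linarith
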